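/- Let X be a Banach space, f_1, f_2 : X → X commuting C^1 maps (f_1 ∘ f_2 = f_2 ∘ f_1), and K ⊆ X a nonempty compact set with f_1(K) = K and f_2(K) = K. Suppose there exists C > 1 such that for every y ∈ K the Fréchet derivative d_y f_2 is a bounded linear isomorphism of X with ‖d_y f_2‖ ≤ C and ‖(d_y f_2)^{−1}‖ ≤ C. Then for every x ∈ K, limsup_{n→∞} (1/n) log ‖d_{f_2 x} f_1^n‖_α = limsup_{n→∞} (1/n) log ‖d_x f_1^n‖_α; that is, the index-of-compactness exponent of f_1 is invariant under f_2: l_α(x, f_1) = l_α(f_2 x, f_1). -/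

import Mathlib

open Filter

/-- The Kuratowski measure of non-compactness of a set `A`: the infimum of all `r > 0`
such that `A` can be covered by finitely many balls of radius at most `r`. -/
noncomputable def alphaMeasure {X : Type*} [SeminormedAddCommGroup X] (A : Set X) : ℝ :=
  sInf {r : ℝ | 0 < r ∧ ∃ S : Finset X, ∃ ρ : X → ℝ,
    (∀ c ∈ S, ρ c ≤ r) ∧ A ⊆ ⋃ c ∈ S, Metric.closedBall c (ρ c)}

/-- The index of compactness `‖g‖_α` of a map `g : X → X`:
`inf {k > 0 : α(g(A)) ≤ k * α(A) for every bounded A ⊆ X}`. -/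
noncomputable def alphaNorm {X : Type*} [SeminormedAddCommGroup X] (g : X → X) : ℝ :=
  sInf {k : ℝ | 0 < k ∧ ∀ A : Set X, Bornology.IsBounded A →
    alphaMeasure (g '' A) ≤ k * alphaMeasure A}

/-- Extended-real logarithm of a nonnegative real number, with `log 0 = -∞`. -/
noncomputable def elog (x : ℝ) : EReal :=
  if x ≤ 0 then (⊥ : EReal) else ((Real.log x : ℝ) : EReal)

/-- The index-of-compactness exponent `l_α(x, g) := limsup_{n→∞} (1/n) log ‖d_x gⁿ‖_α`
(an extended real, with the convention `log 0 = -∞`). -/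
noncomputable def lAlphaAt {X : Type*} [NormedAddCommGroup X] [NormedSpace ℝ X]
    (g : X → X) (x : X) : EReal :=
  Filter.limsup
    (fun n : ℕ => (((n : ℝ)⁻¹ : ℝ) : EReal) * elog (alphaNorm (⇑(fderiv ℝ (g^[n]) x))))
    Filter.atTop

theorem alphaMeasure_image_le {X : Type*} [SeminormedAddCommGroup X] [NormedSpace ℝ X]
    (T : X →L[ℝ] X) {k : ℝ} (hk : 0 < k) (hT : ‖T‖ ≤ k) {A : Set X}
    (hA : Bornology.IsBounded A) : alphaMeasure (T '' A) ≤ k * alphaMeasure A := by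
  classical
  rw [mul_comm, ← div_le_iff₀ hk]
  refine le_csInf ?_ ?_
  · obtain ⟨R, hR⟩ := hA.subset_closedBall 0
    refine ⟨max R 1, by positivity, {0}, fun _ => R, fun _ _ => le_max_left _ _, by simpa using hR⟩
  · rintro r ⟨hr, S, ρ, hρ, hAS⟩
    rw [div_le_iff₀ hk]
    refine csInf_le ⟨0, fun _ hs => hs.1.le⟩ ⟨by positivity, S.image T, fun _ => r * k,
      fun _ _ => le_rfl, ?_⟩
    rintro _ ⟨a, ha, rfl⟩
    obtain ⟨c, hc, hac⟩ := Set.mem_iUnion₂.1 (hAS ha)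
    refine Set.mem_iUnion₂.2 ⟨T c, Finset.mem_image_of_mem _ hc, ?_⟩
    rw [Metric.mem_closedBall, dist_eq_norm] at hac ⊢
    rw [← map_sub, mul_comm r]
    exact (T.le_opNorm _).trans
      (mul_le_mul hT (hac.trans (hρ c hc)) (norm_nonneg _) hk.le)

theorem alphaNorm_comp_le {X : Type*} [SeminormedAddCommGroup X] [NormedSpace ℝ X]
    (P S Q : X →L[ℝ] X) {C : ℝ} (hC : 0 < C) (hP : ‖P‖ ≤ C) (hQ : ‖Q‖ ≤ C) :
    alphaNorm (P ∘L S ∘L Q) ≤ C ^ 2 * alphaNorm S := by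
  rw [mul_comm, ← div_le_iff₀ (by positivity)]
  refine le_csInf ⟨‖S‖ + 1, by positivity, fun A hA =>
    alphaMeasure_image_le S (by positivity) (by linarith) hA⟩ ?_
  rintro k ⟨hk, hS⟩
  rw [div_le_iff₀ (by positivity)]
  refine csInf_le ⟨0, fun _ hs => hs.1.le⟩ ⟨by positivity, fun A hA => ?_⟩
  have hQA : Bornology.IsBounded (Q '' A) := Q.lipschitz.isBounded_image hA
  have hSQA : Bornology.IsBounded (S '' (Q '' A)) := S.lipschitz.isBounded_image hQA
  have himage : (P ∘L S ∘L Q) '' A = P '' (S '' (Q '' A)) := by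
    rw [Set.image_image, Set.image_image]
    rfl
  calc alphaMeasure ((P ∘L S ∘L Q) '' A)
      ≤ C * alphaMeasure (S '' (Q '' A)) := himage ▸ alphaMeasure_image_le P hC hP hSQA
    _ ≤ C * (k * (C * alphaMeasure A)) := by
        gcongr
        exact (hS _ hQA).trans (by gcongr; exact alphaMeasure_image_le Q hC hQ hA)
    _ = k * C ^ 2 * alphaMeasure A := by ring

theorem elog_le_log_add_elog {a b M : ℝ} (hM : 0 < M) (hab : a ≤ M * b) :
    elog a ≤ (Real.log M : EReal) + elog b := by
  unfold elog
  split_ifs with ha hb hb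
  · exact bot_le
  · exact bot_le
  · nlinarith
  · push Not at ha hb
    rw [← EReal.coe_add, EReal.coe_le_coe_iff, ← Real.log_mul hM.ne' hb.ne']
    exact Real.log_le_log ha hab

theorem limsup_inv_mul_elog_le {a b : ℕ → ℝ} {M : ℝ} (hM : 0 < M)
    (hab : ∀ n, a n ≤ M * b n) :
    limsup (fun n : ℕ => (((n : ℝ)⁻¹ : ℝ) : EReal) * elog (a n)) atTop ≤
      limsup (fun n : ℕ => (((n : ℝ)⁻¹ : ℝ) : EReal) * elog (b n)) atTop := by
  set u : ℕ → EReal := fun n => (((n : ℝ)⁻¹ * Real.log M : ℝ) : EReal)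
  have hu : limsup u atTop = 0 := by
    refine Tendsto.limsup_eq ?_
    rw [← EReal.coe_zero, EReal.tendsto_coe]
    simpa using tendsto_inv_atTop_nhds_zero_nat.mul_const (Real.log M)
  calc
    _ ≤ limsup (u + fun n : ℕ => (((n : ℝ)⁻¹ : ℝ) : EReal) * elog (b n)) atTop := by
        refine limsup_le_limsup (Eventually.of_forall fun n => ?_)
        have hn : (0 : EReal) ≤ (((n : ℝ)⁻¹ : ℝ) : EReal) := by
          exact_mod_cast inv_nonneg.2 n.cast_nonneg
        calc _ ≤ (((n : ℝ)⁻¹ : ℝ) : EReal) * ((Real.log M : EReal) + elog (b n)) :=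
              mul_le_mul_of_nonneg_left (elog_le_log_add_elog hM (hab n)) hn
          _ = _ := by
              rw [EReal.left_distrib_of_nonneg_of_ne_top hn (EReal.coe_ne_top _), ← EReal.coe_mul]
              rfl
    _ ≤ limsup u atTop + limsup (fun n : ℕ => (((n : ℝ)⁻¹ : ℝ) : EReal) * elog (b n)) atTop :=
        EReal.limsup_add_le (Or.inl (by simp [hu])) (Or.inl (by simp [hu]))
    _ = _ := by rw [hu, zero_add]

/-- Let `f_1, f_2` be commuting `C¹` maps of a Banach space `X`, `K` a nonempty compact
set with `f_1(K) = K` and `f_2(K) = K`, and suppose there is `C > 1` such that for every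
`y ∈ K` the derivative `d_y f_2` is a bounded linear isomorphism of `X` with
`‖d_y f_2‖ ≤ C` and `‖(d_y f_2)⁻¹‖ ≤ C`.  Then for every `x ∈ K`,
`l_α(f_2 x, f_1) = l_α(x, f_1)`. -/
theorem lAlphaAt_invariant_under_commuting_generator
    {X : Type*} [NormedAddCommGroup X] [NormedSpace ℝ X] [CompleteSpace X]
    (f₁ f₂ : X → X) (h₁ : ContDiff ℝ 1 f₁) (h₂ : ContDiff ℝ 1 f₂)
    (hcomm : f₁ ∘ f₂ = f₂ ∘ f₁)
    (K : Set X) (hK : IsCompact K) (hKne : K.Nonempty)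
    (hK₁ : f₁ '' K = K) (hK₂ : f₂ '' K = K)
    (C : ℝ) (hC : 1 < C)
    (hiso : ∀ y ∈ K, ∃ e : X ≃L[ℝ] X,
      ((e : X →L[ℝ] X) : X → X) = ⇑(fderiv ℝ f₂ y) ∧
      ‖(e : X →L[ℝ] X)‖ ≤ C ∧ ‖((e.symm : X ≃L[ℝ] X) : X →L[ℝ] X)‖ ≤ C) :
    ∀ x ∈ K, lAlphaAt f₁ (f₂ x) = lAlphaAt f₁ x := by
  intro x hx
  have hC₀ : 0 < C := by linarith
  have hd₁ (n : ℕ) : Differentiable ℝ f₁^[n] := (h₁.differentiable one_ne_zero).iterate n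
  have hd₂ : Differentiable ℝ f₂ := h₂.differentiable one_ne_zero
  have hmem (n : ℕ) : f₁^[n] x ∈ K :=
    (Set.mapsTo_iff_image_subset.2 hK₁.subset).iterate n hx
  have hchain (n : ℕ) : fderiv ℝ f₁^[n] (f₂ x) ∘L fderiv ℝ f₂ x =
      fderiv ℝ f₂ (f₁^[n] x) ∘L fderiv ℝ f₁^[n] x := by
    have hcomm_n : f₁^[n] ∘ f₂ = f₂ ∘ f₁^[n] :=
      (Function.Commute.iterate_left (f := f₁) (g := f₂) (congrFun hcomm) n).comp_eq
    rw [← fderiv_comp x (hd₁ n _) (hd₂ _), hcomm_n, fderiv_comp x (hd₂ _) (hd₁ n _)]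
  obtain ⟨e, he, heC, heC'⟩ := hiso x hx
  replace he : (e : X →L[ℝ] X) = fderiv ℝ f₂ x := DFunLike.coe_injective he
  refine le_antisymm (limsup_inv_mul_elog_le (M := C ^ 2) (by positivity) fun n => ?_)
    (limsup_inv_mul_elog_le (M := C ^ 2) (by positivity) fun n => ?_) <;>
  obtain ⟨e', he', heC₁, heC₁'⟩ := hiso _ (hmem n) <;>
  replace he' : (e' : X →L[ℝ] X) = fderiv ℝ f₂ (f₁^[n] x) := DFunLike.coe_injective he' <;>
  have h := hchain n <;>
  rw [← he, ← he'] at h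
  · convert alphaNorm_comp_le (e' : X →L[ℝ] X) (fderiv ℝ f₁^[n] x) (e.symm : X →L[ℝ] X)
      hC₀ heC₁ heC' using 3
    ext v
    simpa using DFunLike.congr_fun h (e.symm v)
  · convert alphaNorm_comp_le (e'.symm : X →L[ℝ] X) (fderiv ℝ f₁^[n] (f₂ x)) (e : X →L[ℝ] X)
      hC₀ heC₁' heC using 3
    rw [h]
    ext v
    simp
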